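/- Let d ≥ 1 and let r ∈ ℕ^d be a multi-index with |r| ≤ t ≤ d. Then there exist coefficients a^r_s ∈ ℝ, indexed by multi-indices s ∈ ℕ^d with |s| = |r|, such that the following holds: for every O(d)-invariant Borel probability measure σ_{1,d} on G_{1,d}, every cubature {(P_j, ω_j)}_{j=1}^n for Hom_t(G_{1,d}), and every Borel probability measure ν on ℝ^d whose absolute moments of order |r| are finite, one has ∫_{ℝ^d} x^r dν(x) = Σ_{j=1}^n ω_j Σ_{s ∈ ℕ^d, |s| = |r|} a^r_s ∫_{ℝ^d} (P_j x)^s dν(x). -/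

import Mathlib

open Matrix MeasureTheory MvPolynomial

noncomputable instance (d : ℕ) : MeasurableSpace (Matrix (Fin d) (Fin d) ℝ) :=
  inferInstanceAs (MeasurableSpace (Fin d → Fin d → ℝ))

/-- The Grassmannian `G_{k,d}` of rank-`k` orthogonal projectors in `ℝ^{d×d}`. -/
def Grass (d k : ℕ) : Set (Matrix (Fin d) (Fin d) ℝ) :=
  {P | P.IsSymm ∧ P * P = P ∧ P.trace = k}

lemma conj_mem_Grass {d k : ℕ} {U : Matrix (Fin d) (Fin d) ℝ}
    (hU : U ∈ Matrix.orthogonalGroup (Fin d) ℝ) {P : Matrix (Fin d) (Fin d) ℝ}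
    (hP : P ∈ Grass d k) : U * P * Uᵀ ∈ Grass d k := by
  obtain ⟨hs, hi, ht⟩ := hP
  have hU2 : Uᵀ * U = 1 := by
    have := (Matrix.mem_orthogonalGroup_iff' (Fin d) ℝ).mp hU
    simpa using this
  refine ⟨?_, ?_, ?_⟩
  · unfold Matrix.IsSymm
    simp [Matrix.transpose_mul, hs.eq, Matrix.mul_assoc]
  · calc U * P * Uᵀ * (U * P * Uᵀ) = U * P * (Uᵀ * U) * P * Uᵀ := by
          simp [Matrix.mul_assoc]
    _ = U * (P * P) * Uᵀ := by simp [hU2, Matrix.mul_assoc]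
    _ = U * P * Uᵀ := by rw [hi]
  · rw [Matrix.trace_mul_cycle, hU2, Matrix.one_mul, ht]

/-- The conjugation action `P ↦ U P Uᵀ` of an orthogonal matrix `U` on the Grassmannian. -/
def conjGrass {d k : ℕ} {U : Matrix (Fin d) (Fin d) ℝ}
    (hU : U ∈ Matrix.orthogonalGroup (Fin d) ℝ) (P : Grass d k) : Grass d k :=
  ⟨U * P.val * Uᵀ, conj_mem_Grass hU P.property⟩

/-- `σ` is an `O(d)`-invariant measure on the Grassmannian `G_{k,d}`. -/
def IsOrthInvariant {d k : ℕ} (σ : Measure (Grass d k)) : Prop :=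
  ∀ U : Matrix (Fin d) (Fin d) ℝ, ∀ hU : U ∈ Matrix.orthogonalGroup (Fin d) ℝ,
    Measure.map (conjGrass hU) σ = σ

/-- `{(P j, ω j)}` is a cubature for `Hom_t(G_{k,d})` with respect to `σ`:
for every homogeneous polynomial `p` of degree `t` in the matrix entries, the integral of `p`
over the Grassmannian equals the weighted sum of point evaluations. -/
def IsCubature {d k : ℕ} (σ : Measure (Grass d k)) {n : ℕ}
    (P : Fin n → Grass d k) (ω : Fin n → ℝ) (t : ℕ) : Prop :=
  ∀ p ∈ MvPolynomial.homogeneousSubmodule (Fin d × Fin d) ℝ t,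
    ∫ Q : Grass d k, MvPolynomial.eval (fun ij => (Q : Matrix (Fin d) (Fin d) ℝ) ij.1 ij.2) p ∂σ =
      ∑ j, ω j * MvPolynomial.eval (fun ij => (P j : Matrix (Fin d) (Fin d) ℝ) ij.1 ij.2) p


lemma poly_vanish {ι : Type*} [Fintype ι] {d : ℕ} (c : ι → Fin d → ℕ) (D : ι → ℝ)
    (hD : ∀ i j, c i = c j → D i = D j)
    (h : ∀ w : Fin d → ℝ, (∀ i, 0 < w i) → ∑ i, D i * ∏ k, w k ^ c i k = 0) :
    ∀ i, D i = 0 := by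
  classical
  intro i0
  let e : (Fin d → ℕ) → (Fin d →₀ ℕ) := Finsupp.equivFunOnFinite.symm
  have he : Function.Injective e := Finsupp.equivFunOnFinite.symm.injective
  let p : MvPolynomial (Fin d) ℝ := ∑ i, monomial (e (c i)) (D i)
  have hp : p = 0 := by
    refine MvPolynomial.funext_set (fun _ => Set.Ioi (0:ℝ)) (fun _ => Set.Ioi_infinite 0) ?_
    intro w hw
    have := h w (fun i => by simpa using hw i (Set.mem_univ i))
    simp only [p, map_sum, eval_monomial, map_zero]
    rw [← this]
    refine Finset.sum_congr rfl fun i _ => ?_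
    rw [Finsupp.prod_fintype _ _ (by simp)]
    rfl
  have hc : coeff (e (c i0)) p = 0 := by rw [hp]; simp
  simp only [p, coeff_sum, coeff_monomial] at hc
  have : ∀ i, (if e (c i) = e (c i0) then D i else 0) = (if c i = c i0 then 1 else 0) * D i0 := by
    intro i
    by_cases hi : c i = c i0
    · simp [hi, hD i i0 hi]
    · have : e (c i) ≠ e (c i0) := fun h => hi (he h)
      simp [hi, this]
  simp_rw [this] at hc
  rw [← Finset.sum_mul] at hc
  rcases mul_eq_zero.mp hc with h1 | h1
  · exfalso
    rw [Finset.sum_eq_zero_iff_of_nonneg (fun i _ => by split_ifs <;> norm_num)] at h1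
    simpa using h1 i0 (Finset.mem_univ _)
  · exact h1

lemma grass_rank_one {d : ℕ} {P : Matrix (Fin d) (Fin d) ℝ} (hP : P ∈ Grass d 1) :
    ∃ v : Fin d → ℝ, ∑ i, v i ^ 2 = 1 ∧ ∀ i j, P i j = v i * v j := by
  obtain ⟨hs, hi, ht⟩ := hP
  have hsym : ∀ i j, P i j = P j i := fun i j => hs.apply j i
  have hmul : ∀ i j, ∑ k, P i k * P k j = P i j := fun i j => by
    conv_rhs => rw [← hi]
    rfl
  have htr : ∑ i, P i i = 1 := by simpa [Matrix.trace] using ht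
  obtain ⟨i0, hi0⟩ : ∃ i, P i i ≠ 0 := by
    by_contra! hcon
    simp [hcon] at htr
  have hdiag : ∀ i, P i i = ∑ k, P i k ^ 2 := fun i => by
    rw [← hmul i i]
    exact Finset.sum_congr rfl fun k _ => by rw [hsym k i, sq]
  have hpos : 0 < P i0 i0 := lt_of_le_of_ne
    (by rw [hdiag]; exact Finset.sum_nonneg fun _ _ => sq_nonneg _) (Ne.symm hi0)
  set c := P i0 i0 with hc
  have hsq : √c * √c = c := Real.mul_self_sqrt hpos.le
  have hsq0 : √c ≠ 0 := (Real.sqrt_pos.mpr hpos).ne'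
  have hvv : ∀ i j, P i i0 / √c * (P j i0 / √c) = P i i0 * P j i0 / c := fun i j => by
    rw [div_mul_div_comm, hsq]
  have hn : ∑ i, P i i0 * P i i0 / c = 1 := by
    rw [← Finset.sum_div, div_eq_one_iff_eq hi0]
    conv_rhs => rw [hc, ← hmul]
    exact Finset.sum_congr rfl fun k _ => by rw [hsym k i0]
  refine ⟨fun i => P i i0 / √c, ?_, ?_⟩
  · rw [← hn]
    exact Finset.sum_congr rfl fun k _ => by rw [sq, hvv]
  · have key : ∑ i, ∑ j, (P i j - P i i0 * P j i0 / c) ^ 2 = 0 := by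
      have h1 : ∀ i, ∑ j, (P i j - P i i0 * P j i0 / c) ^ 2 = P i i - P i i0 * P i i0 / c := by
        intro i
        have : ∀ j, (P i j - P i i0 * P j i0 / c) ^ 2 =
          P i j ^ 2 - 2 * (P i i0 / c) * (P i j * P j i0) + P i i0 ^ 2 / c * (P j i0 * P j i0 / c) := by
          intro j; field_simp; ring
        simp_rw [this]
        rw [Finset.sum_add_distrib, Finset.sum_sub_distrib, ← Finset.mul_sum, ← Finset.mul_sum,
          hmul, hn, ← hdiag]
        ring
      simp_rw [h1]
      rw [Finset.sum_sub_distrib, hn, htr, sub_self]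
    intro i j
    rw [hvv]
    rw [Finset.sum_eq_zero_iff_of_nonneg
      (fun i _ => Finset.sum_nonneg fun j _ => sq_nonneg _)] at key
    have k2 := key i (Finset.mem_univ _)
    rw [Finset.sum_eq_zero_iff_of_nonneg (fun i _ => sq_nonneg _)] at k2
    have k3 := k2 j (Finset.mem_univ _)
    exact sub_eq_zero.mp (pow_eq_zero_iff (two_ne_zero) |>.mp k3)

lemma grass_of_unit {d : ℕ} {v : Fin d → ℝ} (hv : ∑ i, v i ^ 2 = 1) :
    vecMulVec v v ∈ Grass d 1 := by
  refine ⟨?_, ?_, ?_⟩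
  · ext i j; simp [vecMulVec, mul_comm]
  · ext i j
    simp only [Matrix.mul_apply, vecMulVec_apply]
    have : ∀ k, v i * v k * (v k * v j) = v k ^ 2 * (v i * v j) := fun k => by ring
    simp_rw [this]
    rw [← Finset.sum_mul, hv, one_mul]
  · simp [Matrix.trace, vecMulVec_apply, ← sq, hv]

lemma householder {d : ℕ} {v w : Fin d → ℝ} (hv : ∑ i, v i ^ 2 = 1) (hw : ∑ i, w i ^ 2 = 1) :
    ∃ U ∈ Matrix.orthogonalGroup (Fin d) ℝ, U *ᵥ v = w := by
  by_cases hvw : v = w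
  · exact ⟨1, one_mem _, by simp [hvw]⟩
  set u := v - w with hu
  have hvv : v ⬝ᵥ v = 1 := by simpa [dotProduct, sq] using hv
  have hww : w ⬝ᵥ w = 1 := by simpa [dotProduct, sq] using hw
  have huu : u ⬝ᵥ u ≠ 0 := by
    rw [Ne, dotProduct_self_eq_zero, sub_eq_zero]; exact hvw
  have huv : 2 * (u ⬝ᵥ v) = u ⬝ᵥ u := by
    simp only [hu, sub_dotProduct, dotProduct_sub, hvv, hww, dotProduct_comm w v]; ring
  refine ⟨1 - (2 / (u ⬝ᵥ u)) • vecMulVec u u, ?_, ?_⟩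
  · rw [Matrix.mem_orthogonalGroup_iff]
    have : (1 - (2 / (u ⬝ᵥ u)) • vecMulVec u u)ᵀ = (1 - (2 / (u ⬝ᵥ u)) • vecMulVec u u) := by
      ext i j
      simp [Matrix.transpose_apply, vecMulVec_apply, Matrix.one_apply, mul_comm, eq_comm]
    rw [this]
    have h2 : vecMulVec u u * vecMulVec u u = (u ⬝ᵥ u) • vecMulVec u u := by
      rw [vecMulVec_mul_vecMulVec]
      ext i j
      simp [vecMulVec_apply]; ring
    simp only [sub_mul, mul_sub, one_mul, mul_one, smul_mul_assoc, mul_smul_comm, h2, smul_smul]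
    have h3 : 2 / (u ⬝ᵥ u) * (2 / (u ⬝ᵥ u) * (u ⬝ᵥ u)) = 2 / (u ⬝ᵥ u) + 2 / (u ⬝ᵥ u) := by
      field_simp; ring
    ext i j
    simp only [Matrix.sub_apply, Matrix.smul_apply, smul_eq_mul]
    linear_combination vecMulVec u u i j * h3
  · rw [sub_mulVec, one_mulVec, smul_mulVec, vecMulVec_mulVec]
    ext i
    simp only [Pi.sub_apply, Pi.smul_apply, smul_eq_mul, MulOpposite.smul_eq_mul_unop, MulOpposite.unop_op]
    have : 2 / (u ⬝ᵥ u) * (u i * (u ⬝ᵥ v)) = u i := by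
      rw [← huv] at huu ⊢
      have h0 : u ⬝ᵥ v ≠ 0 := fun h => huu (by rw [h, mul_zero])
      field_simp
    rw [this, hu]; simp

lemma grass_transitive {d : ℕ} (P Q : Grass d 1) :
    ∃ (U : Matrix (Fin d) (Fin d) ℝ) (hU : U ∈ Matrix.orthogonalGroup (Fin d) ℝ),
      conjGrass hU P = Q := by
  obtain ⟨v, hv, hP⟩ := grass_rank_one P.2
  obtain ⟨w, hw, hQ⟩ := grass_rank_one Q.2
  obtain ⟨U, hU, hUv⟩ := householder hv hw
  refine ⟨U, hU, Subtype.ext ?_⟩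
  have h1 : P.1 = vecMulVec v v := by ext i j; simp [hP, vecMulVec_apply]
  have h2 : Q.1 = vecMulVec w w := by ext i j; simp [hQ, vecMulVec_apply]
  simp only [conjGrass]
  rw [h1, h2, mul_vecMulVec, vecMulVec_mul, hUv, vecMul_transpose, hUv]

lemma meas_entry {d k : ℕ} (i j : Fin d) : Measurable (fun Q : Grass d k => Q.1 i j) := by
  have h : Measurable (fun M : Fin d → Fin d → ℝ => M i j) := by fun_prop
  exact (show Measurable (fun M : Matrix (Fin d) (Fin d) ℝ => M i j) from h).comp
    measurable_subtype_coe

lemma meas_conj {d k : ℕ} {U : Matrix (Fin d) (Fin d) ℝ}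
    (hU : U ∈ Matrix.orthogonalGroup (Fin d) ℝ) :
    Measurable (conjGrass hU : Grass d k → Grass d k) := by
  refine Measurable.subtype_mk ?_
  refine measurable_pi_lambda (δ := Fin d) (X := fun _ => Fin d → ℝ)
    (fun (Q : Grass d k) => U * Q.1 * Uᵀ) (fun i => measurable_pi_lambda _ fun j => ?_)
  simp only [Matrix.mul_apply]
  exact Finset.measurable_sum _ fun l _ => (Finset.measurable_sum _ fun n _ =>
    (meas_entry n l).const_mul _).mul_const _

lemma entry_bound {d : ℕ} (Q : Grass d 1) (i j : Fin d) : |Q.1 i j| ≤ 1 := by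
  obtain ⟨v, hv, hP⟩ := grass_rank_one Q.2
  have hb : ∀ i, |v i| ≤ 1 := fun i => by
    rw [← sq_le_one_iff_abs_le_one, ← hv]
    exact Finset.single_le_sum (f := fun i => v i ^ 2) (fun _ _ => sq_nonneg _) (Finset.mem_univ i)
  rw [hP, abs_mul]
  exact mul_le_one₀ (hb i) (abs_nonneg _) (hb j)

/-- The number of occurrences of each index in a tuple. -/
def tcnt {d m : ℕ} (J : Fin m → Fin d) (i : Fin d) : ℕ := (Finset.univ.filter (fun k => J k = i)).card

lemma prod_tcnt {d m : ℕ} (J : Fin m → Fin d) (x : Fin d → ℝ) :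
    ∏ k, x (J k) = ∏ i, x i ^ tcnt J i := by
  rw [← Finset.prod_fiberwise' Finset.univ J x]
  exact Finset.prod_congr rfl fun i _ => by rw [Finset.prod_const]; rfl

lemma sum_tcnt {d m : ℕ} (J : Fin m → Fin d) : ∑ i, tcnt J i = m := by
  have := Finset.card_eq_sum_card_fiberwise (f := J) (s := Finset.univ) (t := Finset.univ)
    (fun _ _ => Finset.mem_coe.mpr (Finset.mem_univ _))
  simpa [tcnt] using this.symm

lemma exists_tcnt {d m : ℕ} (s : Fin d → ℕ) (hs : ∑ i, s i = m) :
    ∃ J : Fin m → Fin d, tcnt J = s := by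
  have hc : Fintype.card (Σ i, Fin (s i)) = m := by simp [hs]
  let e := Fintype.equivFinOfCardEq hc
  refine ⟨fun k => (e.symm k).1, ?_⟩
  ext i
  unfold tcnt
  have h1 : (Finset.univ.filter (fun k => (e.symm k).1 = i)).card =
      (Finset.univ.filter (fun k : (Σ i, Fin (s i)) => k.1 = i)).card := by
    refine Finset.card_equiv e.symm ?_
    intro k; simp
  rw [h1, ← Fintype.card_subtype]
  have e2 : {k : (Σ i, Fin (s i)) // k.1 = i} ≃ Fin (s i) := Equiv.sigmaSubtype i
  rw [Fintype.card_congr e2, Fintype.card_fin]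

/-- The mixed moment of an invariant measure indexed by two tuples. -/
noncomputable def gmom {d m : ℕ} (σ : Measure (Grass d 1)) (I J : Fin m → Fin d) : ℝ :=
  ∫ Q : Grass d 1, ∏ k, Q.1 (I k) (J k) ∂σ

lemma prod_entry {d m : ℕ} (Q : Grass d 1) : ∃ v : Fin d → ℝ, ∑ i, v i ^ 2 = 1 ∧
    (∀ i j, Q.1 i j = v i * v j) ∧
    ∀ I J : Fin m → Fin d, ∏ k, Q.1 (I k) (J k) = (∏ i, v i ^ tcnt I i) * ∏ i, v i ^ tcnt J i := by
  obtain ⟨v, hv, h⟩ := grass_rank_one Q.2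
  refine ⟨v, hv, h, fun I J => ?_⟩
  simp_rw [h]
  rw [Finset.prod_mul_distrib, prod_tcnt, prod_tcnt]

lemma gmom_congr {d m : ℕ} (σ : Measure (Grass d 1)) {I J I' J' : Fin m → Fin d}
    (h : tcnt I + tcnt J = tcnt I' + tcnt J') : gmom σ I J = gmom σ I' J' := by
  unfold gmom
  congr 1
  ext Q
  obtain ⟨v, -, -, hv⟩ := prod_entry (m := m) Q
  rw [hv, hv, ← Finset.prod_mul_distrib, ← Finset.prod_mul_distrib]
  refine Finset.prod_congr rfl fun i _ => ?_
  rw [← pow_add, ← pow_add]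
  congr 1
  exact congrFun h i

lemma meas_prod_entry {d m : ℕ} (I J : Fin m → Fin d) :
    Measurable (fun Q : Grass d 1 => ∏ k, Q.1 (I k) (J k)) :=
  Finset.measurable_prod _ fun _ _ => meas_entry _ _

lemma integrable_prod_entry {d m : ℕ} (σ : Measure (Grass d 1)) [IsProbabilityMeasure σ]
    (I J : Fin m → Fin d) :
    Integrable (fun Q : Grass d 1 => ∏ k, Q.1 (I k) (J k)) σ := by
  refine Integrable.of_bound (meas_prod_entry I J).aestronglyMeasurable 1 (ae_of_all _ fun Q => ?_)
  rw [Real.norm_eq_abs, Finset.abs_prod]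
  exact Finset.prod_le_one (fun _ _ => abs_nonneg _) fun _ _ => entry_bound _ _ _

lemma trace_prod {d : ℕ} (P Q : Matrix (Fin d) (Fin d) ℝ) :
    (P * Q).trace = ∑ i, ∑ j, P i j * Q j i := rfl

lemma conj_integral {d : ℕ} {σ : Measure (Grass d 1)} (hσ : IsOrthInvariant σ)
    (m : ℕ) (Q Q' : Grass d 1) :
    ∫ P : Grass d 1, (P.1 * Q.1).trace ^ m ∂σ = ∫ P : Grass d 1, (P.1 * Q'.1).trace ^ m ∂σ := by
  obtain ⟨U, hU, rfl⟩ := grass_transitive Q' Q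
  have hmeas : Measurable (fun P : Grass d 1 => (P.1 * (conjGrass hU Q').1).trace ^ m) := by
    simp only [trace_prod]
    exact (Finset.measurable_sum _ fun l _ => (Finset.measurable_sum _ fun n _ =>
      (meas_entry l n).mul_const _)).pow_const _
  conv_lhs => rw [← hσ U hU]
  rw [integral_map (meas_conj hU).aemeasurable hmeas.aestronglyMeasurable]
  congr 1
  ext P
  have hU2 : Uᵀ * U = 1 := by
    have := (Matrix.mem_orthogonalGroup_iff' (Fin d) ℝ).mp hU
    simpa using this
  simp only [conjGrass]
  congr 1
  calc (U * P.1 * Uᵀ * (U * Q'.1 * Uᵀ)).trace = (U * (P.1 * (Uᵀ * U) * Q'.1) * Uᵀ).trace := by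
        simp only [Matrix.mul_assoc]
    _ = (P.1 * Q'.1).trace := by
        rw [hU2, Matrix.mul_one, Matrix.trace_mul_comm, ← Matrix.mul_assoc, hU2, Matrix.one_mul]

lemma kernel_eq {d : ℕ} {σ σ' : Measure (Grass d 1)} [IsProbabilityMeasure σ]
    [IsProbabilityMeasure σ'] (hσ : IsOrthInvariant σ) (hσ' : IsOrthInvariant σ')
    (m : ℕ) (Q : Grass d 1) :
    ∫ P : Grass d 1, (P.1 * Q.1).trace ^ m ∂σ = ∫ P : Grass d 1, (P.1 * Q.1).trace ^ m ∂σ' := by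
  have hint : Integrable (Function.uncurry
      (fun P P' : Grass d 1 => (P.1 * P'.1).trace ^ m)) (σ.prod σ') := by
    have hmeas : Measurable (Function.uncurry
        (fun P P' : Grass d 1 => (P.1 * P'.1).trace ^ m)) := by
      simp only [trace_prod, Function.uncurry_def]
      exact (Finset.measurable_sum _ fun l _ => (Finset.measurable_sum _ fun n _ =>
        ((meas_entry l n).comp measurable_fst).mul
          ((meas_entry n l).comp measurable_snd))).pow_const _
    refine Integrable.of_bound hmeas.aestronglyMeasurable ((∑ i : Fin d, ∑ j : Fin d, 1) ^ m)
      (ae_of_all _ fun Q => ?_)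
    simp only [Function.uncurry_def, trace_prod, Real.norm_eq_abs, abs_pow]
    refine pow_le_pow_left₀ (abs_nonneg _) ?_ _
    refine (Finset.abs_sum_le_sum_abs _ _).trans (Finset.sum_le_sum fun i _ => ?_)
    refine (Finset.abs_sum_le_sum_abs _ _).trans (Finset.sum_le_sum fun j _ => ?_)
    rw [abs_mul]
    exact mul_le_one₀ (entry_bound _ _ _) (abs_nonneg _) (entry_bound _ _ _)
  have h := integral_integral_swap hint
  have h1 : ∀ P : Grass d 1, ∫ P' : Grass d 1, (P.1 * P'.1).trace ^ m ∂σ' =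
      ∫ P' : Grass d 1, (P'.1 * Q.1).trace ^ m ∂σ' := fun P => by
    rw [conj_integral hσ' m Q P]
    simp_rw [Matrix.trace_mul_comm P.1]
  have h2 : ∀ P' : Grass d 1, ∫ P : Grass d 1, (P.1 * P'.1).trace ^ m ∂σ =
      ∫ P : Grass d 1, (P.1 * Q.1).trace ^ m ∂σ := fun P => conj_integral hσ m P Q
  simp_rw [h1, h2] at h
  simpa using h.symm

lemma sum_pos_sq {d : ℕ} (hd : 1 ≤ d) {w : Fin d → ℝ} (hw : ∀ i, 0 < w i) :
    ∃ c : ℝ, 0 < c ∧ ∃ u : Fin d → ℝ, (∑ i, u i ^ 2 = 1) ∧ ∀ i, w i = c * u i := by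
  have hS : 0 < ∑ i, w i ^ 2 :=
    Finset.sum_pos (fun i _ => pow_pos (hw i) 2) ⟨⟨0, hd⟩, Finset.mem_univ _⟩
  have hc := Real.sqrt_pos.mpr hS
  refine ⟨√(∑ i, w i ^ 2), hc, fun i => w i / √(∑ i, w i ^ 2), ?_, fun i => ?_⟩
  · simp_rw [div_pow]
    rw [← Finset.sum_div, Real.sq_sqrt hS.le, div_self hS.ne']
  · field_simp

lemma trace_expand {d m : ℕ} (P : Matrix (Fin d) (Fin d) ℝ) (w : Fin d → ℝ) :
    (∑ i, ∑ j, P i j * (w j * w i)) ^ m =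
      ∑ K : (Fin m → Fin d) × (Fin m → Fin d),
        (∏ k, P (K.1 k) (K.2 k)) * ∏ i, w i ^ ((tcnt K.1 + tcnt K.2) i) := by
  have h1 : (∑ i, ∑ j, P i j * (w j * w i)) ^ m =
      ∏ _k : Fin m, ∑ x : Fin d × Fin d, P x.1 x.2 * (w x.2 * w x.1) := by
    rw [Finset.prod_const, Finset.card_univ, Fintype.card_fin, Fintype.sum_prod_type]
  rw [h1, Finset.prod_univ_sum, Fintype.piFinset_univ]
  refine Fintype.sum_equiv (Equiv.arrowProdEquivProdArrow (Fin m) (fun _ => Fin d) (fun _ => Fin d))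
    _ _ ?_
  intro K
  rw [Finset.prod_mul_distrib, Finset.prod_mul_distrib]
  simp only [Pi.add_apply, pow_add]
  rw [Finset.prod_mul_distrib, ← prod_tcnt, ← prod_tcnt, mul_comm (∏ k, w (K k).2)]
  rfl

lemma gmom_unique {d m : ℕ} (hd : 1 ≤ d) {σ σ' : Measure (Grass d 1)} [IsProbabilityMeasure σ]
    [IsProbabilityMeasure σ'] (hσ : IsOrthInvariant σ) (hσ' : IsOrthInvariant σ')
    (I J : Fin m → Fin d) : gmom σ I J = gmom σ' I J := by
  have hexp : ∀ (τ : Measure (Grass d 1)) [IsProbabilityMeasure τ] (w : Fin d → ℝ),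
      ∫ P : Grass d 1, (∑ i, ∑ j, P.1 i j * (w j * w i)) ^ m ∂τ =
        ∑ K : (Fin m → Fin d) × (Fin m → Fin d),
          gmom τ K.1 K.2 * ∏ i, w i ^ ((tcnt K.1 + tcnt K.2) i) := by
    intro τ _ w
    simp_rw [trace_expand]
    rw [integral_finsetSum _ fun K _ => (integrable_prod_entry τ K.1 K.2).mul_const _]
    exact Finset.sum_congr rfl fun K _ => by rw [integral_mul_const]; rfl
  have key := poly_vanish (fun K : (Fin m → Fin d) × (Fin m → Fin d) => tcnt K.1 + tcnt K.2)
    (fun K => gmom σ K.1 K.2 - gmom σ' K.1 K.2)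
    (fun K L h => by
      rw [gmom_congr σ h, gmom_congr σ' h]) (fun w hw => by
      simp_rw [sub_mul]
      rw [Finset.sum_sub_distrib, ← hexp, ← hexp, sub_eq_zero]
      obtain ⟨c, hc, u, hu, hwu⟩ := sum_pos_sq hd hw
      have h1 : ∀ P : Grass d 1, (∑ i, ∑ j, P.1 i j * (w j * w i)) ^ m =
          (c ^ 2) ^ m * (P.1 * vecMulVec u u).trace ^ m := by
        intro P
        rw [← mul_pow, trace_prod]
        simp_rw [Finset.mul_sum, hwu, vecMulVec_apply]
        congr 1
        exact Finset.sum_congr rfl fun i _ => Finset.sum_congr rfl fun j _ => by ring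
      simp_rw [h1]
      rw [integral_const_mul, integral_const_mul]
      congr 1
      exact kernel_eq hσ hσ' m ⟨_, grass_of_unit hu⟩)
  exact sub_eq_zero.mp (key (I, J))

lemma zero_everywhere {d : ℕ} {σ : Measure (Grass d 1)} [IsProbabilityMeasure σ]
    (hσ : IsOrthInvariant σ) (F : Matrix (Fin d) (Fin d) ℝ → ℝ) (hF : Continuous F)
    (h0 : ∀ᵐ Q : Grass d 1 ∂σ, F Q.1 = 0) (Q : Grass d 1) : F Q.1 = 0 := by
  have hsc : SecondCountableTopology (Matrix (Fin d) (Fin d) ℝ) :=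
    inferInstanceAs (SecondCountableTopology (Fin d → Fin d → ℝ))
  have hsc2 : SecondCountableTopology ↥(Matrix.orthogonalGroup (Fin d) ℝ) :=
    TopologicalSpace.Subtype.secondCountableTopology _
  obtain ⟨S, hSc, hSd⟩ := TopologicalSpace.exists_countable_dense
    (↥(Matrix.orthogonalGroup (Fin d) ℝ))
  have h1 : ∀ U : ↥(Matrix.orthogonalGroup (Fin d) ℝ), ∀ᵐ Q : Grass d 1 ∂σ,
      F (conjGrass U.2 Q).1 = 0 := by
    intro U
    rw [← hσ U.1 U.2] at h0
    exact ae_of_ae_map (meas_conj U.2).aemeasurable h0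
  have h2 : ∀ᵐ Q : Grass d 1 ∂σ, ∀ U ∈ S, F (conjGrass U.2 Q).1 = 0 :=
    (ae_ball_iff hSc).mpr fun U _ => h1 U
  obtain ⟨P, hP⟩ := h2.exists
  have hcont : Continuous (fun U : ↥(Matrix.orthogonalGroup (Fin d) ℝ) =>
      F (conjGrass U.2 P).1) := by
    simp only [conjGrass]
    refine hF.comp ?_
    fun_prop
  have h3 : (fun U : ↥(Matrix.orthogonalGroup (Fin d) ℝ) => F (conjGrass U.2 P).1) =
      fun _ => 0 := Continuous.ext_on hSd hcont continuous_const fun U hU => hP U hU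
  obtain ⟨U, hU, rfl⟩ := grass_transitive P Q
  exact congrFun h3 ⟨U, hU⟩

lemma gram_solve {d m : ℕ} (hd : 1 ≤ d) {σ : Measure (Grass d 1)} [IsProbabilityMeasure σ]
    (hσ : IsOrthInvariant σ) {ι : Type*} [Fintype ι] (I : ι → Fin m → Fin d)
    (hI : Function.Injective fun s => tcnt (I s)) (b : ι → ℝ) :
    ∃ a : ι → ℝ, ∀ s', ∑ s, a s * gmom σ (I s) (I s') = b s' := by
  classical
  let T : (ι → ℝ) →ₗ[ℝ] (ι → ℝ) :=
    { toFun := fun a s' => ∑ s, a s * gmom σ (I s) (I s')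
      map_add' := fun a a' => by ext s'; simp [add_mul, Finset.sum_add_distrib]
      map_smul' := fun c a => by ext s'; simp [Finset.mul_sum, mul_assoc] }
  suffices hT : Function.Surjective T by
    obtain ⟨a, ha⟩ := hT b
    exact ⟨a, fun s' => congrFun ha s'⟩
  rw [← LinearMap.injective_iff_surjective, injective_iff_map_eq_zero]
  intro a ha
  let F : Matrix (Fin d) (Fin d) ℝ → ℝ := fun Q =>
    ∑ s', a s' * ∑ s, a s * ∏ k, Q (I s k) (I s' k)
  have hFc : Continuous F := by
    refine continuous_finsetSum _ fun s' _ => continuous_const.mul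
      (continuous_finsetSum _ fun s _ => continuous_const.mul
        (continuous_finsetProd _ fun k _ => ?_))
    exact continuous_id.matrix_elem _ _
  have hint : ∀ s s', Integrable (fun Q : Grass d 1 => a s * ∏ k, Q.1 (I s k) (I s' k)) σ :=
    fun s s' => (integrable_prod_entry σ _ _).const_mul _
  have hint2 : ∀ s', Integrable
      (fun Q : Grass d 1 => a s' * ∑ s, a s * ∏ k, Q.1 (I s k) (I s' k)) σ :=
    fun s' => (integrable_finsetSum _ fun s _ => hint s s').const_mul _
  have hFint : ∫ Q : Grass d 1, F Q.1 ∂σ = 0 := by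
    simp only [F]
    rw [integral_finsetSum _ fun s' _ => hint2 s']
    refine Finset.sum_eq_zero fun s' _ => ?_
    rw [integral_const_mul, integral_finsetSum _ fun s _ => hint s s']
    simp_rw [integral_const_mul]
    have : ∑ s, a s * gmom σ (I s) (I s') = 0 := congrFun ha s'
    unfold gmom at this
    rw [this, mul_zero]
  have hFsq : ∀ (v : Fin d → ℝ) (Q : Grass d 1), (∀ I J : Fin m → Fin d,
      ∏ k, Q.1 (I k) (J k) = (∏ i, v i ^ tcnt I i) * ∏ i, v i ^ tcnt J i) →
      F Q.1 = (∑ s, a s * ∏ i, v i ^ tcnt (I s) i) ^ 2 := by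
    intro v Q h
    simp only [F, h]
    rw [sq, Finset.sum_mul]
    refine Finset.sum_congr rfl fun s' _ => ?_
    rw [mul_assoc]
    congr 1
    rw [Finset.mul_sum]
    exact Finset.sum_congr rfl fun s _ => by ring
  have hae : ∀ᵐ Q : Grass d 1 ∂σ, F Q.1 = 0 := by
    refine (integral_eq_zero_iff_of_nonneg ?_ (integrable_finsetSum _ fun s' _ => hint2 s')).mp hFint
    intro Q
    obtain ⟨v, -, -, hv⟩ := prod_entry (m := m) Q
    exact (sq_nonneg _).trans_eq (hFsq v Q hv).symm
  have hall := zero_everywhere hσ F hFc hae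
  ext s
  refine poly_vanish (fun s => tcnt (I s)) a (fun s s' h => by rw [hI h]) ?_ s
  intro w hw
  obtain ⟨c, hc, u, hu, hwu⟩ := sum_pos_sq hd hw
  have h1 := hall ⟨_, grass_of_unit hu⟩
  rw [hFsq u _ (fun I J => by
    simp only [vecMulVec_apply]
    rw [Finset.prod_mul_distrib, prod_tcnt, prod_tcnt])] at h1
  have h2 := pow_eq_zero_iff (two_ne_zero) |>.mp h1
  have h3 : ∀ s, ∏ i, w i ^ tcnt (I s) i = c ^ m * ∏ i, u i ^ tcnt (I s) i := by
    intro s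
    simp_rw [hwu, mul_pow]
    rw [Finset.prod_mul_distrib, Finset.prod_pow_eq_pow_sum, sum_tcnt]
  simp_rw [h3, mul_left_comm _ (c ^ m)]
  rw [← Finset.mul_sum, h2, mul_zero]

lemma cubature_gmom {d t m n : ℕ} (hm : m ≤ t) {σ : Measure (Grass d 1)}
    {P : Fin n → Grass d 1} {ω : Fin n → ℝ} (h : IsCubature σ P ω t) (I J : Fin m → Fin d) :
    gmom σ I J = ∑ j, ω j * ∏ k, (P j).1 (I k) (J k) := by
  let p : MvPolynomial (Fin d × Fin d) ℝ := (∏ k, X (I k, J k)) * (∑ i, X (i, i)) ^ (t - m)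
  have hp : p ∈ MvPolynomial.homogeneousSubmodule (Fin d × Fin d) ℝ t := by
    rw [mem_homogeneousSubmodule]
    have h1 : (∏ k, X (I k, J k) : MvPolynomial (Fin d × Fin d) ℝ).IsHomogeneous m := by
      have := IsHomogeneous.prod (Finset.univ : Finset (Fin m))
        (fun k => (X (I k, J k) : MvPolynomial (Fin d × Fin d) ℝ)) (fun _ => 1)
        (fun _ _ => isHomogeneous_X _ _)
      simpa using this
    have h2 : (∑ i, X (i, i) : MvPolynomial (Fin d × Fin d) ℝ).IsHomogeneous 1 :=
      IsHomogeneous.sum _ _ _ fun _ _ => isHomogeneous_X _ _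
    have h3 := h1.mul (h2.pow (t - m))
    rwa [one_mul, Nat.add_sub_cancel' hm] at h3
  have hev : ∀ Q : Grass d 1, MvPolynomial.eval (fun ij => Q.1 ij.1 ij.2) p =
      ∏ k, Q.1 (I k) (J k) := by
    intro Q
    have ht : ∑ i, Q.1 i i = 1 := by simpa [Matrix.trace] using Q.2.2.2
    simp [p, ht, map_prod]
  have := h p hp
  simp_rw [hev] at this
  exact this

/-- Reconstruction of high-dimensional moments from one-dimensional projected
moments via cubatures on `G_{1,d}`: for every multi-index `r` with `|r| ≤ t ≤ d` there are
coefficients `a s` (for `|s| = |r|`) such that for every `O(d)`-invariant probability measure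
on `G_{1,d}`, every cubature for `Hom_t(G_{1,d})` and every probability measure `ν` on `ℝ^d`
with finite absolute moments of order `|r|`, the moment `𝔼 X^r` equals the stated weighted
combination of the moments of the projected vectors `P j • X`. -/
theorem moment_reconstruction_from_projections (d t : ℕ) (hd : 1 ≤ d)
    (r : Fin d → ℕ) (hrt : ∑ i, r i ≤ t) (htd : t ≤ d) :
    ∃ a : (Fin d → ℕ) → ℝ,
      ∀ (σ : Measure (Grass d 1)), IsProbabilityMeasure σ → IsOrthInvariant σ →
        ∀ (n : ℕ) (P : Fin n → Grass d 1) (ω : Fin n → ℝ), IsCubature σ P ω t →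
          ∀ (ν : Measure (Fin d → ℝ)), IsProbabilityMeasure ν →
            (∀ s : Fin d → ℕ, ∑ i, s i = ∑ i, r i →
              Integrable (fun x => ∏ i, |x i| ^ s i) ν) →
            ∫ x, ∏ i, x i ^ r i ∂ν =
              ∑ j, ω j * ∑ s ∈ Finset.Nat.antidiagonalTuple d (∑ i, r i),
                a s * ∫ x, ∏ i, ((P j : Matrix (Fin d) (Fin d) ℝ).mulVec x i) ^ s i ∂ν := by
  classical
  by_cases hex : ∃ σ : Measure (Grass d 1), IsProbabilityMeasure σ ∧ IsOrthInvariant σ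
  swap
  · exact ⟨fun _ => 0, fun σ h1 h2 => absurd ⟨σ, h1, h2⟩ hex⟩
  obtain ⟨σ₀, hσ₀p, hσ₀⟩ := hex
  set m := ∑ i, r i with hm
  set S := Finset.Nat.antidiagonalTuple d m with hS
  have hex : ∀ s : S, ∃ J : Fin m → Fin d, tcnt J = s.1 := fun s =>
    exists_tcnt s.1 (Finset.Nat.mem_antidiagonalTuple.mp s.2)
  choose I hI using hex
  let N : ℝ := ((Finset.univ.filter (fun J : Fin m → Fin d => tcnt J = r)).card : ℝ)
  have hN : N ≠ 0 := by
    obtain ⟨J, hJ⟩ := exists_tcnt r hm.symm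
    simp only [N, ne_eq, Nat.cast_eq_zero, Finset.card_eq_zero]
    exact Finset.Nonempty.ne_empty ⟨J, by simp [hJ]⟩
  obtain ⟨a, ha⟩ := gram_solve hd hσ₀ I
    (fun s s' h => Subtype.ext (by simpa [hI] using h)) (fun s => if s.1 = r then N⁻¹ else 0)
  refine ⟨fun s => if h : s ∈ S then a ⟨s, h⟩ else 0, ?_⟩
  intro σ hσp hσ n P ω hcub ν hν hmom
  have haJ : ∀ J : Fin m → Fin d, ∑ s, a s * gmom σ (I s) J = if tcnt J = r then N⁻¹ else 0 := by
    intro J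
    have hJS : tcnt J ∈ S := Finset.Nat.mem_antidiagonalTuple.mpr (sum_tcnt J)
    have := ha ⟨tcnt J, hJS⟩
    simp only at this
    rw [← this]
    refine Finset.sum_congr rfl fun s _ => ?_
    rw [gmom_unique hd hσ hσ₀, gmom_congr σ₀ (I' := I s) (J' := I ⟨tcnt J, hJS⟩)]
    rw [hI ⟨tcnt J, hJS⟩]
  have hint : ∀ J : Fin m → Fin d, Integrable (fun x : Fin d → ℝ => ∏ i, x i ^ tcnt J i) ν := by
    intro J
    refine (hmom (tcnt J) (sum_tcnt J)).mono' (Continuous.aestronglyMeasurable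
      (continuous_finsetProd _ fun i _ => (continuous_apply i).pow _)) (ae_of_all _ fun x => ?_)
    rw [Real.norm_eq_abs, Finset.abs_prod]
    simp_rw [abs_pow]
    exact le_rfl
  have hproj : ∀ (j : Fin n) (s : S), ∫ x, ∏ i, ((P j).1.mulVec x i) ^ s.1 i ∂ν =
      ∑ J : Fin m → Fin d, (∏ k, (P j).1 (I s k) (J k)) * ∫ x, ∏ i, x i ^ tcnt J i ∂ν := by
    intro j s
    have h1 : ∀ x : Fin d → ℝ, ∏ i, ((P j).1.mulVec x i) ^ s.1 i =
        ∑ J : Fin m → Fin d, (∏ k, (P j).1 (I s k) (J k)) * ∏ i, x i ^ tcnt J i := by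
      intro x
      rw [← hI s, ← prod_tcnt]
      simp only [Matrix.mulVec, dotProduct]
      rw [Finset.prod_univ_sum, Fintype.piFinset_univ]
      refine Finset.sum_congr rfl fun J _ => ?_
      rw [Finset.prod_mul_distrib, prod_tcnt J]
    simp_rw [h1]
    rw [integral_finsetSum _ fun J _ => (hint J).const_mul _]
    simp_rw [integral_const_mul]
  have hrhs : ∀ j, ∑ s ∈ S, (if h : s ∈ S then a ⟨s, h⟩ else 0) *
      ∫ x, ∏ i, ((P j).1.mulVec x i) ^ s i ∂ν =
      ∑ s : S, a s * ∑ J : Fin m → Fin d,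
        (∏ k, (P j).1 (I s k) (J k)) * ∫ x, ∏ i, x i ^ tcnt J i ∂ν := by
    intro j
    rw [← Finset.sum_coe_sort S]
    refine Finset.sum_congr rfl fun s _ => ?_
    rw [dif_pos s.2, hproj]
  simp_rw [hrhs, Finset.mul_sum]
  rw [Finset.sum_comm]
  simp_rw [Finset.sum_comm (s := (Finset.univ : Finset (Fin n)))]
  rw [Finset.sum_comm]
  have hfin : ∀ J : Fin m → Fin d, ∑ s : S, ∑ j, ω j * (a s * ((∏ k, (P j).1 (I s k) (J k)) *
      ∫ x, ∏ i, x i ^ tcnt J i ∂ν)) = (if tcnt J = r then N⁻¹ * ∫ x, ∏ i, x i ^ r i ∂ν else 0) := by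
    intro J
    have : ∀ s : S, ∑ j, ω j * (a s * ((∏ k, (P j).1 (I s k) (J k)) *
      ∫ x, ∏ i, x i ^ tcnt J i ∂ν)) = a s * gmom σ (I s) J * ∫ x, ∏ i, x i ^ tcnt J i ∂ν := by
      intro s
      rw [cubature_gmom hrt hcub, Finset.mul_sum, Finset.sum_mul]
      exact Finset.sum_congr rfl fun j _ => by ring
    simp_rw [this]
    rw [← Finset.sum_mul, haJ]
    split_ifs with h
    · rw [h]
    · rw [zero_mul]
  simp_rw [hfin]
  rw [← Finset.sum_filter, Finset.sum_const, nsmul_eq_mul]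
  change _ = N * _
  rw [mul_inv_cancel_left₀ hN]
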